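/- Let 𝒜 be a σ-field of subsets of ℕ (a collection containing ∅, closed under complements and countable unions). Then the following are equivalent: (1) 𝒜 ⊆ F and ν is countably additive on 𝒜, i.e. for every pairwise disjoint sequence {A_k}_{k=1}^∞ ⊆ 𝒜, ν(⋃_{k=1}^∞ A_k) = ∑_{k=1}^∞ ν(A_k); (2) there exists a countable partition S of ℕ such that S ⊆ F, ∑_{A ∈ S} ν(A) = 1, and 𝒜 is the σ-field generated by S (equivalently, 𝒜 consists exactly of the unions of subfamilies of S). -/

import Mathlib

/-- The partial average `ν_N(A) = (1/N)·∑_{n=1}^N 1_A(n)`. -/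
noncomputable def nuN (A : Set ℕ) (N : ℕ) : ℝ :=
  (∑ n ∈ Finset.Icc 1 N, A.indicator (fun _ => (1 : ℝ)) n) / N

/-- The upper Cesàro limit `ν⁺(A)`. -/
noncomputable def nuPlus (A : Set ℕ) : ℝ :=
  Filter.limsup (fun N => nuN A N) Filter.atTop

/-- The lower Cesàro limit `ν⁻(A)`. -/
noncomputable def nuMinus (A : Set ℕ) : ℝ :=
  Filter.liminf (fun N => nuN A N) Filter.atTop

/-- `A ∈ F`: the Cesàro limit of `A` exists. -/
def memF (A : Set ℕ) : Prop :=
  ∃ l : ℝ, Filter.Tendsto (fun N => nuN A N) Filter.atTop (nhds l)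

/-- The Cesàro limit `ν(A)`; it coincides with `ν⁺(A)` whenever `A ∈ F`. -/
noncomputable def nu (A : Set ℕ) : ℝ := nuPlus A

/-- `A ∈ N`: `A` is a null set. -/
def nullSet (A : Set ℕ) : Prop := memF A ∧ nu A = 0

open Filter Topology

lemma nuN_mono {A B : Set ℕ} (h : A ⊆ B) (N : ℕ) : nuN A N ≤ nuN B N := by
  unfold nuN
  gcongr

lemma nuN_nonneg (A : Set ℕ) (N : ℕ) : 0 ≤ nuN A N :=
  div_nonneg (Finset.sum_nonneg fun _ _ => Set.indicator_nonneg (fun _ _ => zero_le_one) _)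
    N.cast_nonneg

lemma nuN_univ {N : ℕ} (hN : N ≠ 0) : nuN Set.univ N = 1 := by
  simp [nuN, hN]

lemma nuN_compl (A : Set ℕ) {N : ℕ} (hN : N ≠ 0) : nuN Aᶜ N = 1 - nuN A N := by
  rw [← nuN_univ hN, eq_sub_iff_add_eq, nuN, nuN, nuN, ← add_div, ← Finset.sum_add_distrib]
  simp_rw [Set.indicator_compl_add_self_apply, Set.indicator_univ]

lemma nuN_biUnion {ι : Type*} {P : ι → Set ℕ} (hP : Pairwise (Function.onFun Disjoint P))
    (T : Finset ι) (N : ℕ) : nuN (⋃ i ∈ T, P i) N = ∑ i ∈ T, nuN (P i) N := by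
  simp only [nuN]
  rw [← Finset.sum_div, Finset.sum_comm]
  congr 1
  refine Finset.sum_congr rfl fun n _ => ?_
  exact Finset.indicator_biUnion_apply T P (fun i _ j _ hij => hP hij) n

lemma nu_eq_of_tendsto {A : Set ℕ} {l : ℝ} (h : Tendsto (nuN A) atTop (𝓝 l)) : nu A = l :=
  h.limsup_eq

lemma memF.tendsto {A : Set ℕ} (h : memF A) : Tendsto (nuN A) atTop (𝓝 (nu A)) := by
  obtain ⟨l, hl⟩ := h
  rwa [nu_eq_of_tendsto hl]

lemma memF.nu_nonneg {A : Set ℕ} (h : memF A) : 0 ≤ nu A :=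
  ge_of_tendsto' h.tendsto (nuN_nonneg A)

lemma nu_empty : nu ∅ = 0 :=
  nu_eq_of_tendsto (tendsto_const_nhds.congr fun N => by simp [nuN])

lemma nu_univ : nu Set.univ = 1 :=
  nu_eq_of_tendsto (tendsto_const_nhds.congr' <|
    (eventually_ne_atTop 0).mono fun _ hN => (nuN_univ hN).symm)

section Partition

variable {ι : Type*} {P : ι → Set ℕ}

lemma eventually_lt_nuN_biUnion (hP : Pairwise (Function.onFun Disjoint P))
    (hF : ∀ i, memF (P i)) (hs : Summable fun i => nu (P i)) (C : Set ι) {c : ℝ}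
    (hc : c < ∑' i, C.indicator (fun i => nu (P i)) i) :
    ∀ᶠ N in atTop, c < nuN (⋃ i ∈ C, P i) N := by
  classical
  obtain ⟨T, hT⟩ := ((hs.indicator C).hasSum.eventually (lt_mem_nhds hc)).exists
  have hT' : c < ∑ i ∈ T with i ∈ C, nu (P i) := by
    simpa [Finset.sum_filter, Set.indicator_apply] using hT
  filter_upwards [(tendsto_finsetSum {i ∈ T | i ∈ C} fun i _ =>
    (hF i).tendsto).eventually (lt_mem_nhds hT')] with N hN
  rw [← nuN_biUnion hP] at hN
  refine hN.trans_le (nuN_mono (Set.iUnion₂_subset fun i hi => ?_) N)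
  exact Set.subset_biUnion_of_mem (u := P) (Finset.mem_filter.1 hi).2

lemma compl_biUnion_of_partition (hP : Pairwise (Function.onFun Disjoint P))
    (hU : ⋃ i, P i = Set.univ) (C : Set ι) : (⋃ i ∈ C, P i)ᶜ = ⋃ i ∈ Cᶜ, P i := by
  refine Set.Subset.antisymm ?_ ?_
  · rw [Set.compl_subset_iff_union, ← Set.biUnion_union, Set.union_compl_self, Set.biUnion_univ, hU]
  · simp only [Set.subset_compl_iff_disjoint_left, Set.disjoint_iUnion_left,
      Set.disjoint_iUnion_right]
    exact fun i hi j hj => hP fun h => hi (h ▸ hj)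

lemma tendsto_nuN_biUnion (hP : Pairwise (Function.onFun Disjoint P))
    (hU : ⋃ i, P i = Set.univ) (hF : ∀ i, memF (P i)) (hs : HasSum (fun i => nu (P i)) 1)
    (C : Set ι) :
    Tendsto (nuN (⋃ i ∈ C, P i)) atTop (𝓝 (∑' i, C.indicator (fun i => nu (P i)) i)) := by
  have hadd : ∑' i, C.indicator (fun i => nu (P i)) i +
      ∑' i, Cᶜ.indicator (fun i => nu (P i)) i = 1 := by
    rw [← (hs.summable.indicator C).tsum_add (hs.summable.indicator Cᶜ), ← hs.tsum_eq]
    simp_rw [Set.indicator_self_add_compl_apply]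
  refine tendsto_order.2 ⟨fun c hc => eventually_lt_nuN_biUnion hP hF hs.summable C hc,
    fun c hc => ?_⟩
  filter_upwards [eventually_ne_atTop 0,
    eventually_lt_nuN_biUnion hP hF hs.summable Cᶜ (c := 1 - c) (by linarith)] with N h0 hN
  rw [← compl_biUnion_of_partition hP hU, nuN_compl _ h0] at hN
  linarith

lemma tsum_indicator_iUnion {f : ι → ℝ} (hf : 0 ≤ f) (hs : Summable f) {C : ℕ → Set ι}
    (hC : Pairwise (Function.onFun Disjoint C)) :
    ∑' i, (⋃ k, C k).indicator f i = ∑' k, ∑' i, (C k).indicator f i := by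
  have hsum (i : ι) : HasSum (fun k => (C k).indicator f i) ((⋃ k, C k).indicator f i) := by
    by_cases hi : i ∈ ⋃ k, C k
    · obtain ⟨k, hk⟩ := Set.mem_iUnion.1 hi
      rw [Set.indicator_of_mem hi, ← Set.indicator_of_mem hk f]
      exact hasSum_single k fun j hj => Set.indicator_of_notMem
        (fun h => (hC hj).le_bot ⟨h, hk⟩) f
    · rw [Set.indicator_of_notMem hi]
      convert hasSum_zero with k
      exact Set.indicator_of_notMem (fun h => hi (Set.mem_iUnion.2 ⟨k, h⟩)) f
  have hsummable : Summable (Function.uncurry fun i k => (C k).indicator f i) := by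
    refine (summable_prod_of_nonneg fun p => Set.indicator_nonneg (fun i _ => hf i) _).2
      ⟨fun i => (hsum i).summable, ?_⟩
    simpa only [Function.uncurry_apply_pair, (hsum _).tsum_eq] using hs.indicator _
  rw [hsummable.tsum_comm]
  exact tsum_congr fun i => (hsum i).tsum_eq.symm

lemma nu_iUnion_biUnion (hP : Pairwise (Function.onFun Disjoint P)) (hne : ∀ i, (P i).Nonempty)
    (hU : ⋃ i, P i = Set.univ) (hF : ∀ i, memF (P i)) (hs : HasSum (fun i => nu (P i)) 1)
    {C : ℕ → Set ι}
    (hC : Pairwise (Function.onFun Disjoint fun k => ⋃ i ∈ C k, P i)) :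
    nu (⋃ k, ⋃ i ∈ C k, P i) = ∑' k, nu (⋃ i ∈ C k, P i) := by
  have hC' : Pairwise (Function.onFun Disjoint C) := fun j k hjk =>
    Set.disjoint_left.2 fun i hj hk => by
      obtain ⟨x, hx⟩ := hne i
      exact (hC hjk).le_bot ⟨Set.mem_biUnion hj hx, Set.mem_biUnion hk hx⟩
  have hnu (D : Set ι) := nu_eq_of_tendsto (tendsto_nuN_biUnion hP hU hF hs D)
  rw [← Set.biUnion_iUnion, hnu, tsum_indicator_iUnion (fun i => (hF i).nu_nonneg) hs.summable hC']
  simp_rw [hnu]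

end Partition

lemma tsum_nu_eq_one {𝒜 : Set (Set ℕ)} (hempty : ∅ ∈ 𝒜)
    (hadd : ∀ A : ℕ → Set ℕ, (∀ k, A k ∈ 𝒜) → Pairwise (Function.onFun Disjoint A) →
      nu (⋃ k, A k) = ∑' k, nu (A k))
    {ι : Type*} [Countable ι] {P : ι → Set ℕ} (hP : Pairwise (Function.onFun Disjoint P))
    (hmem : ∀ i, P i ∈ 𝒜) (hU : ⋃ i, P i = Set.univ) : ∑' i, nu (P i) = 1 := by
  have := Encodable.ofCountable ι
  rw [← tsum_iUnion_decode₂ nu nu_empty P, ← hadd _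
    (fun k => Encodable.iUnion_decode₂_cases (C := (· ∈ 𝒜)) hempty hmem)
    (Encodable.iUnion_decode₂_disjoint_on hP), Encodable.iUnion_decode₂, hU, nu_univ]

lemma measurableSet_iff_exists_sUnion_measurableAtom {α : Type*} [Countable α]
    [MeasurableSpace α] {B : Set α} :
    MeasurableSet B ↔ ∃ C ⊆ Set.range (measurableAtom (β := α)), B = ⋃₀ C := by
  constructor
  · refine fun hB => ⟨measurableAtom '' B, Set.image_subset_range _ _, ?_⟩
    refine Set.Subset.antisymm (fun x hx => ⟨_, ⟨x, hx, rfl⟩, mem_measurableAtom_self x⟩) ?_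
    rintro _ ⟨_, ⟨y, hy, rfl⟩, hxy⟩
    exact measurableAtom_subset hB hy hxy
  · rintro ⟨C, hC, rfl⟩
    refine MeasurableSet.sUnion ((Set.countable_range _).mono hC) fun t ht => ?_
    obtain ⟨x, rfl⟩ := hC ht
    exact MeasurableSet.measurableAtom_of_countable x

lemma pairwiseDisjoint_range_measurableAtom {α : Type*} [MeasurableSpace α] :
    (Set.range (measurableAtom (β := α))).PairwiseDisjoint id := by
  rintro _ ⟨x, rfl⟩ _ ⟨y, rfl⟩ hxy
  exact disjoint_measurableAtom_of_notMem fun h => hxy (measurableAtom_eq_of_mem h)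

theorem stmt19 (𝒜 : Set (Set ℕ))
    (hempty : ∅ ∈ 𝒜) (hcompl : ∀ A ∈ 𝒜, Aᶜ ∈ 𝒜)
    (hunion : ∀ A : ℕ → Set ℕ, (∀ k, A k ∈ 𝒜) → (⋃ k, A k) ∈ 𝒜) :
    ((∀ A ∈ 𝒜, memF A) ∧
      ∀ A : ℕ → Set ℕ, (∀ k, A k ∈ 𝒜) → Pairwise (Function.onFun Disjoint A) →
        nu (⋃ k, A k) = ∑' k, nu (A k)) ↔
    (∃ S : Set (Set ℕ), S.Countable ∧ (∀ A ∈ S, A.Nonempty) ∧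
      S.PairwiseDisjoint id ∧ ⋃₀ S = Set.univ ∧
      (∀ A ∈ S, memF A) ∧ (∑' A : S, nu (A : Set ℕ)) = 1 ∧
      𝒜 = {B | ∃ C ⊆ S, B = ⋃₀ C}) := by
  constructor
  · rintro ⟨hF, hadd⟩
    let m : MeasurableSpace ℕ := ⟨(· ∈ 𝒜), hempty, hcompl, hunion⟩
    have hcount : (Set.range (measurableAtom (β := ℕ))).Countable := Set.countable_range _
    have := hcount.to_subtype
    have hmem : ∀ A ∈ Set.range (measurableAtom (β := ℕ)), A ∈ 𝒜 := by
      rintro _ ⟨n, rfl⟩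
      exact MeasurableSet.measurableAtom_of_countable n
    have hU : ⋃₀ Set.range (measurableAtom (β := ℕ)) = Set.univ :=
      Set.eq_univ_of_forall fun n => ⟨_, ⟨n, rfl⟩, mem_measurableAtom_self n⟩
    refine ⟨_, hcount, ?_, pairwiseDisjoint_range_measurableAtom, hU,
      fun A hA => hF A (hmem A hA), ?_,
      Set.ext fun B => measurableSet_iff_exists_sUnion_measurableAtom (B := B)⟩
    · rintro _ ⟨n, rfl⟩
      exact ⟨n, mem_measurableAtom_self n⟩
    · exact tsum_nu_eq_one hempty hadd
        ((pairwise_subtype_iff_pairwise_set _ _).2 pairwiseDisjoint_range_measurableAtom)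
        (fun A => hmem A A.2) (by rwa [← Set.sUnion_eq_iUnion])
  · rintro ⟨S, -, hne, hdisj, hU, hF, hsum, rfl⟩
    have hP : Pairwise (Function.onFun Disjoint fun A : S => (A : Set ℕ)) :=
      (pairwise_subtype_iff_pairwise_set _ _).2 hdisj
    have hF' (A : S) : memF A := hF A A.2
    rw [Set.sUnion_eq_iUnion] at hU
    have hs : HasSum (fun A : S => nu (A : Set ℕ)) 1 := by
      have : Summable fun A : S => nu (A : Set ℕ) := by
        by_contra h
        exact zero_ne_one ((tsum_eq_zero_of_not_summable h).symm.trans hsum)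
      exact hsum ▸ this.hasSum
    have hB : ∀ B ∈ {B | ∃ C ⊆ S, B = ⋃₀ C}, ∃ D : Set S, B = ⋃ A ∈ D, (A : Set ℕ) := by
      rintro _ ⟨C, hC, rfl⟩
      refine ⟨Subtype.val ⁻¹' C, ?_⟩
      rw [← Set.sUnion_image, Subtype.image_preimage_coe, Set.inter_eq_right.2 hC]
    constructor
    · intro B h
      obtain ⟨D, rfl⟩ := hB B h
      exact ⟨_, tendsto_nuN_biUnion hP hU hF' hs D⟩
    · intro A hA hAd
      choose D hD using fun k => hB _ (hA k)
      obtain rfl : A = fun k => ⋃ B ∈ D k, (B : Set ℕ) := funext hD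
      exact nu_iUnion_biUnion hP (fun B => hne B B.2) hU hF' hs hAd
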